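/- Let λ = (λ_{IJ}) be a sequence and let (u_I)_{I∈D}, (g_J)_{J∈D} be families of L²(ℝ) functions with only finitely many nonzero members. Define a_i(x,y) := 2^{i/2} u_{I_i(x)}(y) and b_j(x,y) := 2^{j/2} g_{I_j(y)}(x) for i,j ∈ ℤ and (x,y) ∈ ℝ². Then Σ_{I,J} λ_{IJ} ⟨g_J⟩_I ⟨u_I⟩_J = Σ_{j∈ℤ} ∬_{ℝ²} (M_λ a)_j(x,y) b_j(x,y) dx dy, and moreover Σ_{i∈ℤ} ‖a_i‖_{L²(ℝ²)}² = Σ_{I∈D} ‖u_I‖_{L²(ℝ)}² and Σ_{j∈ℤ} ‖b_j‖_{L²(ℝ²)}² = Σ_{J∈D} ‖g_J‖_{L²(ℝ)}². -/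

import Mathlib

open MeasureTheory
open scoped ENNReal

noncomputable section

/-- A sequence `λ = (λ_{IJ})` indexed by pairs of dyadic intervals; a dyadic interval
`[2^{-i}k, 2^{-i}(k+1))` is encoded by the pair `(i, k) : ℤ × ℤ`. -/
abbrev ParaSeq := (ℤ × ℤ) → (ℤ × ℤ) → ℝ

/-- The dyadic interval `[2^{-i} k, 2^{-i}(k+1))` encoded by the pair `p = (i, k) : ℤ × ℤ`. -/
def dyadic (p : ℤ × ℤ) : Set ℝ := Set.Ico ((2:ℝ) ^ (-p.1) * p.2) ((2:ℝ) ^ (-p.1) * (p.2 + 1))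

/-- The length `|I| = 2^{-i}` of the dyadic interval encoded by `p = (i, k)`. -/
def dlen (p : ℤ × ℤ) : ℝ := (2:ℝ) ^ (-p.1)

/-- The average `⟨f⟩_I = |I|⁻¹ ∫_I f`. -/
def avg (f : ℝ → ℝ) (p : ℤ × ℤ) : ℝ := (dlen p)⁻¹ * ∫ x in dyadic p, f x

/-- Admissible families `(u_I)_{I ∈ D}` of `L²(ℝ)` functions: only finitely many nonzero
members and `Σ_I ‖u_I‖₂² = 1`. -/
def Adm : Set ((ℤ × ℤ) → ℝ → ℝ) :=
  {u | (∀ p, MemLp (u p) 2 volume) ∧ {p | u p ≠ 0}.Finite ∧ (∑' p : ℤ × ℤ, ∫ x, (u p x) ^ 2) = 1}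

/-- The bilinear sum `Σ_{I,J} λ_{IJ} ⟨g_J⟩_I ⟨u_I⟩_J`. -/
def pairSum (lam : ParaSeq) (u g : (ℤ × ℤ) → ℝ → ℝ) : ℝ :=
  ∑' pq : (ℤ × ℤ) × (ℤ × ℤ), lam pq.1 pq.2 * avg (g pq.2) pq.1 * avg (u pq.1) pq.2

/-- The norm `‖λ‖_X`, as an element of `[0, ∞]`. -/
def Xnorm (lam : ParaSeq) : ℝ≥0∞ :=
  ⨆ (u : Adm) (g : Adm), ENNReal.ofReal |pairSum lam u.1 g.1|

/-- The norm `‖λ‖_{X'}`, as an element of `[0, ∞]`. -/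
def Xprime (lam : ParaSeq) : ℝ≥0∞ :=
  ⨆ (u : Adm) (g : Adm),
    ENNReal.ofReal
      (∑' pq : (ℤ × ℤ) × (ℤ × ℤ), |lam pq.1 pq.2 * avg (g.1 pq.2) pq.1 * avg (u.1 pq.1) pq.2|)

/-- `I_i(x)`: (the encoding of) the unique dyadic interval of length `2^{-i}` containing `x`. -/
def Iat (i : ℤ) (x : ℝ) : ℤ × ℤ := (i, ⌊(2:ℝ) ^ i * x⌋)

/-- The matrix entries `M_λ^{ij}(x,y) = 2^{(i+j)/2} λ_{I_i(x) I_j(y)}`. -/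
def Ment (lam : ParaSeq) (i j : ℤ) (z : ℝ × ℝ) : ℝ :=
  (2:ℝ) ^ (((i : ℝ) + (j : ℝ)) / 2) * lam (Iat i z.1) (Iat j z.2)

/-- `(M_λ a)_j(x,y) = Σ_i M_λ^{ij}(x,y) a_i(x,y)`. -/
def Mapply (lam : ParaSeq) (a : ℤ → ℝ × ℝ → ℝ) (j : ℤ) (z : ℝ × ℝ) : ℝ :=
  ∑' i : ℤ, Ment lam i j z * a i z

/-- The unit ball of `ℓ²_ℤ(L²(ℝ²))` (measurable representatives). -/
def Mball : Set (ℤ → ℝ × ℝ → ℝ) :=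
  {a | (∀ i, Measurable (a i)) ∧ (∑' i : ℤ, ∫⁻ z : ℝ × ℝ, ENNReal.ofReal ((a i z) ^ 2)) ≤ 1}

/-- The operator norm `‖M_λ‖` of `M_λ` on `ℓ²_ℤ(L²(ℝ²))`, as an element of `[0, ∞]`. -/
def MopNorm (lam : ParaSeq) : ℝ≥0∞ :=
  ⨆ a : Mball,
    (∑' j : ℤ, ∫⁻ z : ℝ × ℝ, ENNReal.ofReal ((Mapply lam a.1 j z) ^ 2)) ^ (1/2 : ℝ)

/-- `a_i(x,y) = 2^{i/2} u_{I_i(x)}(y)`. -/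
def aseq (u : (ℤ × ℤ) → ℝ → ℝ) (i : ℤ) (z : ℝ × ℝ) : ℝ :=
  (2:ℝ) ^ ((i : ℝ) / 2) * u (Iat i z.1) z.2

/-- `b_j(x,y) = 2^{j/2} g_{I_j(y)}(x)`. -/
def bseq (g : (ℤ × ℤ) → ℝ → ℝ) (j : ℤ) (z : ℝ × ℝ) : ℝ :=
  (2:ℝ) ^ ((j : ℝ) / 2) * g (Iat j z.2) z.1

lemma Iat_eq_iff (i : ℤ) (x : ℝ) (p : ℤ × ℤ) : Iat i x = p ↔ p.1 = i ∧ x ∈ dyadic p := by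
  obtain ⟨a, b⟩ := p
  simp only [Iat, dyadic, Prod.mk.injEq, Set.mem_Ico]
  constructor
  · rintro ⟨rfl, h⟩
    rw [Int.floor_eq_iff] at h
    have h2 : (0:ℝ) < 2 ^ i := by positivity
    rw [zpow_neg, inv_mul_le_iff₀ h2, lt_inv_mul_iff₀ h2]
    exact ⟨rfl, h⟩
  · rintro ⟨rfl, h⟩
    have h2 : (0:ℝ) < 2 ^ a := by positivity
    rw [zpow_neg, inv_mul_le_iff₀ h2, lt_inv_mul_iff₀ h2] at h
    exact ⟨rfl, Int.floor_eq_iff.2 h⟩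

lemma measurableSet_dyadic (p : ℤ × ℤ) : MeasurableSet (dyadic p) := measurableSet_Ico

lemma volume_dyadic (p : ℤ × ℤ) : volume (dyadic p) = ENNReal.ofReal (2 ^ (-p.1)) := by
  rw [dyadic, Real.volume_Ico]
  ring_nf

lemma integrable_indicator_dyadic {f : ℝ → ℝ} (hf : MemLp f 2 volume) (p : ℤ × ℤ) :
    Integrable ((dyadic p).indicator f) := by
  have : IsFiniteMeasure (volume.restrict (dyadic p)) :=
    isFiniteMeasure_restrict.2 (by rw [volume_dyadic]; exact ENNReal.ofReal_ne_top)
  rw [integrable_indicator_iff (measurableSet_dyadic p)]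
  exact (hf.restrict (dyadic p)).integrable one_le_two

/-- A function of the dyadic interval `I_i(x)`, supported on a finite set of intervals, as a
finite sum of indicators. -/
lemma apply_Iat_eq_sum {S : Finset (ℤ × ℤ)} {F : ℤ × ℤ → ℝ} (hF : ∀ p ∉ S, F p = 0)
    (i : ℤ) (x : ℝ) :
    F (Iat i x) = ∑ p ∈ S, if p.1 = i then (dyadic p).indicator (fun _ => F p) x else 0 := by
  classical
  have h : ∀ p, (if p.1 = i then (dyadic p).indicator (fun _ => F p) x else 0)
      = if Iat i x = p then F p else 0 := by
    intro p
    simp only [Iat_eq_iff, ite_and, Set.indicator_apply]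
  simp only [h, Finset.sum_ite_eq]
  split_ifs with h'
  · rfl
  · exact hF _ h'

/-- Summing over the generations recovers the sum over all intervals of a finite set. -/
lemma tsum_sum_ite_fst {ι : Type*} (S : Finset ι) (φ : ι → ℤ) (F : ι → ℝ) :
    ∑' i : ℤ, ∑ p ∈ S, (if φ p = i then F p else 0) = ∑ p ∈ S, F p := by
  rw [Summable.tsum_finsetSum]
  · exact Finset.sum_congr rfl fun p _ => by simp_rw [eq_comm (a := φ p)]; exact tsum_ite_eq (φ p) _
  · exact fun p _ => summable_of_ne_finset_zero (s := {φ p}) fun i hi =>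
      if_neg fun h => hi (by simp [h])

lemma two_rpow_half_mul_self (i : ℤ) :
    (2:ℝ) ^ ((i : ℝ) / 2) * (2:ℝ) ^ ((i : ℝ) / 2) = 2 ^ i := by
  rw [← Real.rpow_add two_pos, add_halves, Real.rpow_intCast]

lemma Mapply_aseq_mul_bseq (lam : ParaSeq) {u g : ℤ × ℤ → ℝ → ℝ} {S T : Finset (ℤ × ℤ)}
    (hS : ∀ p ∉ S, u p = 0) (hT : ∀ q ∉ T, g q = 0) (j : ℤ) (z : ℝ × ℝ) :
    Mapply lam (aseq u) j z * bseq g j z = ∑ pq ∈ S ×ˢ T, if pq.2.1 = j then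
      lam pq.1 pq.2 * ((dlen pq.1)⁻¹ * (dlen pq.2)⁻¹) *
        ((dyadic pq.1).indicator (g pq.2) z.1 * (dyadic pq.2).indicator (u pq.1) z.2) else 0 := by
  have hterm : ∀ i, Ment lam i j z * aseq u i z * bseq g j z = ∑ p ∈ S, if p.1 = i then
      (dyadic p).indicator (fun _ => ∑ q ∈ T, if q.1 = j then (dyadic q).indicator
        (fun _ => 2 ^ p.1 * 2 ^ q.1 * lam p q * u p z.2 * g q z.1) z.2 else 0) z.1 else 0 := by
    intro i
    rw [← apply_Iat_eq_sum (F := fun p => ∑ q ∈ T, if q.1 = j then (dyadic q).indicator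
        (fun _ => 2 ^ p.1 * 2 ^ q.1 * lam p q * u p z.2 * g q z.1) z.2 else 0)]
    · rw [← apply_Iat_eq_sum
        (F := fun q => 2 ^ (Iat i z.1).1 * 2 ^ q.1 * lam (Iat i z.1) q * u (Iat i z.1) z.2
          * g q z.1)]
      · rw [Ment, aseq, bseq, add_div, Real.rpow_add two_pos]
        change _ = 2 ^ i * 2 ^ j * _ * _ * _
        rw [← two_rpow_half_mul_self i, ← two_rpow_half_mul_self j]
        ring
      · intro q hq
        simp [hT q hq]
    · intro p hp
      simp [hS p hp]
  rw [Mapply, ← tsum_mul_right]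
  simp_rw [hterm]
  rw [tsum_sum_ite_fst, Finset.sum_product]
  refine Finset.sum_congr rfl fun p _ => ?_
  by_cases h1 : z.1 ∈ dyadic p
  · rw [Set.indicator_of_mem h1]
    refine Finset.sum_congr rfl fun q _ => ?_
    by_cases h2 : z.2 ∈ dyadic q
    · simp only [h1, h2, Set.indicator_of_mem, dlen, zpow_neg, inv_inv]
      congr 1
      ring
    · simp [h2]
  · simp [h1]

lemma integral_aseq_sq {u : ℤ × ℤ → ℝ → ℝ} (hu2 : ∀ p, MemLp (u p) 2 volume)
    {S : Finset (ℤ × ℤ)} (hS : ∀ p ∉ S, u p = 0) (i : ℤ) :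
    ∫ z : ℝ × ℝ, (aseq u i z) ^ 2 = ∑ p ∈ S, if p.1 = i then ∫ x, (u p x) ^ 2 else 0 := by
  have hpt : ∀ z : ℝ × ℝ, (aseq u i z) ^ 2 = ∑ p ∈ S, if p.1 = i then
      (dyadic p).indicator (fun _ => (2:ℝ) ^ p.1) z.1 * (u p z.2) ^ 2 else 0 := by
    intro z
    have h := apply_Iat_eq_sum (S := S) (F := fun p => 2 ^ p.1 * (u p z.2) ^ 2)
      (fun p hp => by simp [hS p hp]) i z.1
    simp only [Set.indicator_mul_const] at h
    rw [← h, aseq, mul_pow, sq ((2:ℝ) ^ _), two_rpow_half_mul_self, Iat]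
  have hind : ∀ p : ℤ × ℤ, Integrable ((dyadic p).indicator (fun _ => (2:ℝ) ^ p.1)) := fun p =>
    (integrable_indicator_iff (measurableSet_dyadic p)).2
      (integrableOn_const (by rw [volume_dyadic]; exact ENNReal.ofReal_ne_top))
  simp_rw [hpt]
  rw [integral_finsetSum]
  · refine Finset.sum_congr rfl fun p _ => ?_
    split_ifs
    · rw [Measure.volume_eq_prod, integral_prod_mul
        ((dyadic p).indicator (fun _ => (2:ℝ) ^ p.1)) (fun y => (u p y) ^ 2),
        integral_indicator (measurableSet_dyadic p), setIntegral_const, Measure.real,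
        volume_dyadic, ENNReal.toReal_ofReal (by positivity), smul_eq_mul, zpow_neg,
        inv_mul_cancel₀ (by positivity), one_mul]
    · simp
  · intro p _
    split_ifs
    · exact (hind p).mul_prod (hu2 p).integrable_sq
    · exact integrable_zero _ _ _

lemma tsum_integral_aseq_sq {u : ℤ × ℤ → ℝ → ℝ} (hu2 : ∀ p, MemLp (u p) 2 volume)
    (hufin : {p | u p ≠ 0}.Finite) :
    ∑' i : ℤ, ∫ z : ℝ × ℝ, (aseq u i z) ^ 2 = ∑' p : ℤ × ℤ, ∫ x, (u p x) ^ 2 := by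
  have hS : ∀ p ∉ hufin.toFinset, u p = 0 := by simp
  simp_rw [integral_aseq_sq hu2 hS]
  rw [tsum_sum_ite_fst, tsum_eq_sum]
  intro p hp
  simp [hS p hp]

lemma integral_bseq_sq_eq (g : ℤ × ℤ → ℝ → ℝ) (j : ℤ) :
    ∫ z : ℝ × ℝ, (bseq g j z) ^ 2 = ∫ z : ℝ × ℝ, (aseq g j z) ^ 2 :=
  integral_prod_swap (μ := (volume : Measure ℝ)) (ν := (volume : Measure ℝ))
    (fun z : ℝ × ℝ => (aseq g j z) ^ 2)

lemma integral_Mapply_aseq_mul_bseq (lam : ParaSeq) {u g : ℤ × ℤ → ℝ → ℝ}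
    (hu2 : ∀ p, MemLp (u p) 2 volume) (hg2 : ∀ q, MemLp (g q) 2 volume)
    {S T : Finset (ℤ × ℤ)} (hS : ∀ p ∉ S, u p = 0) (hT : ∀ q ∉ T, g q = 0) (j : ℤ) :
    ∫ z : ℝ × ℝ, Mapply lam (aseq u) j z * bseq g j z = ∑ pq ∈ S ×ˢ T, if pq.2.1 = j then
      lam pq.1 pq.2 * avg (g pq.2) pq.1 * avg (u pq.1) pq.2 else 0 := by
  simp_rw [Mapply_aseq_mul_bseq lam hS hT]
  rw [integral_finsetSum]
  · refine Finset.sum_congr rfl fun pq _ => ?_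
    split_ifs
    · rw [integral_const_mul, Measure.volume_eq_prod, integral_prod_mul,
        integral_indicator (measurableSet_dyadic _), integral_indicator (measurableSet_dyadic _),
        avg, avg]
      ring
    · simp
  · intro pq _
    split_ifs
    · exact ((integrable_indicator_dyadic (hg2 _) _).mul_prod
        (integrable_indicator_dyadic (hu2 _) _)).const_mul _
    · exact integrable_zero _ _ _

/-- with `a_i(x,y) = 2^{i/2} u_{I_i(x)}(y)` and `b_j(x,y) = 2^{j/2} g_{I_j(y)}(x)`,
one has `Σ_{I,J} λ_{IJ} ⟨g_J⟩_I ⟨u_I⟩_J = Σ_j ∬ (M_λ a)_j b_j`, and the `ℓ²(L²)` norms match: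
`Σ_i ‖a_i‖₂² = Σ_I ‖u_I‖₂²` and `Σ_j ‖b_j‖₂² = Σ_J ‖g_J‖₂²`. -/
theorem pairSum_eq_Mpairing (lam : ParaSeq) (u g : (ℤ × ℤ) → ℝ → ℝ)
    (hu2 : ∀ p, MemLp (u p) 2 volume) (hg2 : ∀ q, MemLp (g q) 2 volume)
    (hufin : {p | u p ≠ 0}.Finite) (hgfin : {q | g q ≠ 0}.Finite) :
    pairSum lam u g = (∑' j : ℤ, ∫ z : ℝ × ℝ, Mapply lam (aseq u) j z * bseq g j z) ∧
    (∑' i : ℤ, ∫ z : ℝ × ℝ, (aseq u i z) ^ 2) = (∑' p : ℤ × ℤ, ∫ x, (u p x) ^ 2) ∧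
    (∑' j : ℤ, ∫ z : ℝ × ℝ, (bseq g j z) ^ 2) = (∑' q : ℤ × ℤ, ∫ x, (g q x) ^ 2) := by
  have hS : ∀ p ∉ hufin.toFinset, u p = 0 := by simp
  have hT : ∀ q ∉ hgfin.toFinset, g q = 0 := by simp
  refine ⟨?_, tsum_integral_aseq_sq hu2 hufin, ?_⟩
  · simp_rw [integral_Mapply_aseq_mul_bseq lam hu2 hg2 hS hT]
    rw [tsum_sum_ite_fst _ (fun pq : (ℤ × ℤ) × (ℤ × ℤ) => pq.2.1), pairSum, tsum_eq_sum]
    intro pq hpq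
    rw [Finset.mem_product, not_and_or] at hpq
    rcases hpq with h | h
    · simp [avg, hS _ h]
    · simp [avg, hT _ h]
  · simp_rw [integral_bseq_sq_eq]
    exact tsum_integral_aseq_sq hg2 hgfin

end
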